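/- arXiv:2401.02917 — 2 statements merged into one kernel-verified Lean document; each statement's English description precedes it below -/
import Mathlib

section
/- Proposition 1 (unimodality): suppose γ > 0, κ* ∈ {1, ..., n−1}, a_i < −γ for all i ≤ κ*, and a_i > γ for all i > κ*. Then the probability mass function κ ↦ π(κ) on {1, ..., n−1} is strictly increasing on {1, ..., κ*} and strictly decreasing on {κ*, ..., n−1}; i.e., π(κ) < π(κ+1) whenever 1 ≤ κ < κ*, and π(κ) > π(κ+1) whenever κ* ≤ κ ≤ n−2. -/
open Real Finset

/-- The logistic (inverse logit) function `F(t) = eᵗ / (1 + eᵗ)`. -/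
noncomputable def F (t : ℝ) : ℝ := Real.exp t / (1 + Real.exp t)

/-- The quasi-likelihood `Q(κ) = ∏_{i=1}^{κ} (1 − F(a_i)) · ∏_{i=κ+1}^{n} F(a_i)`. -/
noncomputable def Q (n : ℕ) (a : ℕ → ℝ) (κ : ℕ) : ℝ :=
  (∏ i ∈ Finset.Icc 1 κ, (1 - F (a i))) * ∏ i ∈ Finset.Icc (κ + 1) n, F (a i)

/-- The posterior probability mass function `π(κ) = Q(κ) / ∑_{k=1}^{n−1} Q(k)`. -/
noncomputable def post (n : ℕ) (a : ℕ → ℝ) (κ : ℕ) : ℝ :=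
  Q n a κ / ∑ k ∈ Finset.Icc 1 (n - 1), Q n a k

lemma F_pos (t : ℝ) : 0 < F t := by
  unfold F
  positivity

lemma one_sub_F (t : ℝ) : 1 - F t = 1 / (1 + Real.exp t) := by
  unfold F
  field_simp
  ring

lemma one_sub_F_pos (t : ℝ) : 0 < 1 - F t := by
  rw [one_sub_F]
  positivity

lemma F_lt_one_sub_F {t : ℝ} (ht : t < 0) : F t < 1 - F t := by
  rw [one_sub_F]
  unfold F
  gcongr
  exact Real.exp_lt_one_iff.mpr ht

lemma one_sub_F_lt_F {t : ℝ} (ht : 0 < t) : 1 - F t < F t := by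
  rw [one_sub_F]
  unfold F
  gcongr
  exact Real.one_lt_exp_iff.mpr ht

lemma Q_pos (n : ℕ) (a : ℕ → ℝ) (κ : ℕ) : 0 < Q n a κ :=
  mul_pos (Finset.prod_pos fun _ _ => one_sub_F_pos _) (Finset.prod_pos fun _ _ => F_pos _)

/-- `Q n a κ` and `Q n a (κ + 1)` differ only in the factor contributed by `a (κ + 1)`. -/
lemma exists_common_factor (n : ℕ) (a : ℕ → ℝ) {κ : ℕ} (hκ : κ + 1 ≤ n) :
    ∃ c, 0 < c ∧ Q n a κ = c * F (a (κ + 1)) ∧ Q n a (κ + 1) = c * (1 - F (a (κ + 1))) := by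
  refine ⟨(∏ i ∈ Finset.Icc 1 κ, (1 - F (a i))) * ∏ i ∈ Finset.Icc (κ + 1 + 1) n, F (a i),
    mul_pos (Finset.prod_pos fun _ _ => one_sub_F_pos _) (Finset.prod_pos fun _ _ => F_pos _),
    ?_, ?_⟩
  · rw [Q, ← Finset.insert_Icc_add_one_left_eq_Icc hκ, Finset.prod_insert (by simp)]
    ring
  · rw [Q, Finset.prod_Icc_succ_top (by omega)]
    ring

lemma post_lt_post_iff {n : ℕ} (hn : 2 ≤ n) (a : ℕ → ℝ) (κ l : ℕ) :
    post n a κ < post n a l ↔ Q n a κ < Q n a l :=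
  div_lt_div_iff_of_pos_right <|
    Finset.sum_pos (fun _ _ => Q_pos _ _ _) (Finset.nonempty_Icc.mpr (by omega))

/-- Proposition 1 (unimodality): under the separation hypothesis, the posterior pmf
`κ ↦ π(κ)` is strictly increasing on `{1, …, κ*}` and strictly decreasing on
`{κ*, …, n−1}`. -/
theorem posterior_unimodal (n : ℕ) (hn : 2 ≤ n) (a : ℕ → ℝ) (γ : ℝ) (hγ : 0 < γ)
    (κstar : ℕ) (hκs1 : 1 ≤ κstar) (hκs2 : κstar ≤ n - 1)
    (hpre : ∀ i, 1 ≤ i → i ≤ κstar → a i < -γ)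
    (hpost : ∀ i, κstar < i → i ≤ n → γ < a i) :
    (∀ κ, 1 ≤ κ → κ < κstar → post n a κ < post n a (κ + 1)) ∧
    (∀ κ, κstar ≤ κ → κ ≤ n - 2 → post n a (κ + 1) < post n a κ) := by
  refine ⟨fun κ h1 h2 => ?_, fun κ h1 h2 => ?_⟩ <;>
    obtain ⟨c, hc, hQ, hQ'⟩ := exists_common_factor n a (κ := κ) (by omega) <;>
    rw [post_lt_post_iff hn, hQ, hQ', mul_lt_mul_iff_right₀ hc]
  · exact F_lt_one_sub_F ((hpre (κ + 1) (by omega) (by omega)).trans (neg_lt_zero.mpr hγ))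
  · exact one_sub_F_lt_F (hγ.trans (hpost (κ + 1) (by omega) (by omega)))
end

section
/- Proposition 1 (recovery of the true changepoint): suppose γ > 0, κ* ∈ {1, ..., n−1}, a_i < −γ for all i ≤ κ*, and a_i > γ for all i > κ*. Then κ* is the unique maximizer of π over {1, ..., n−1}: for every κ ∈ {1, ..., n−1} with κ ≠ κ*, one has π(κ) < π(κ*). -/
open Real Finset

lemma Q_eq_prod_ite {n κ : ℕ} (a : ℕ → ℝ) (hκ : κ ≤ n) :
    Q n a κ = ∏ i ∈ Finset.Icc 1 n, if i ≤ κ then 1 - F (a i) else F (a i) := by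
  rw [Finset.prod_ite, Q]
  congr 2 <;> ext i <;> simp only [Finset.mem_Icc, Finset.mem_filter] <;> omega

lemma Q_lt_Q {n κ κstar : ℕ} {a : ℕ → ℝ} (hκ1 : 1 ≤ κ) (hκn : κ ≤ n) (hsn : κstar ≤ n)
    (hpre : ∀ i, 1 ≤ i → i ≤ κstar → a i < 0) (hpost : ∀ i, κstar < i → i ≤ n → 0 < a i)
    (hne : κ ≠ κstar) : Q n a κ < Q n a κstar := by
  rw [Q_eq_prod_ite a hκn, Q_eq_prod_ite a hsn]
  refine Finset.prod_lt_prod (fun i _ => ?_) (fun i hi => ?_) ⟨max κ κstar, ?_, ?_⟩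
  · split_ifs
    exacts [one_sub_F_pos _, F_pos _]
  · rw [Finset.mem_Icc] at hi
    split_ifs with h₁ h₂ h₂
    · exact le_rfl
    · exact (one_sub_F_lt_F (hpost i (by omega) hi.2)).le
    · exact (F_lt_one_sub_F (hpre i hi.1 h₂)).le
    · exact le_rfl
  · rw [Finset.mem_Icc]
    omega
  · rcases hne.lt_or_gt with h | h
    · rw [max_eq_right h.le, if_neg h.not_ge, if_pos le_rfl]
      exact F_lt_one_sub_F (hpre _ (by omega) le_rfl)
    · rw [max_eq_left h.le, if_pos le_rfl, if_neg h.not_ge]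
      exact one_sub_F_lt_F (hpost _ h hκn)

/-- Proposition 1 (recovery of the true changepoint): under the separation hypothesis,
`κ*` is the unique maximizer of `π` over `{1, …, n−1}`. -/
theorem posterior_argmax (n : ℕ) (hn : 2 ≤ n) (a : ℕ → ℝ) (γ : ℝ) (hγ : 0 < γ)
    (κstar : ℕ) (hκs1 : 1 ≤ κstar) (hκs2 : κstar ≤ n - 1)
    (hpre : ∀ i, 1 ≤ i → i ≤ κstar → a i < -γ)
    (hpost : ∀ i, κstar < i → i ≤ n → γ < a i) :
    ∀ κ, 1 ≤ κ → κ ≤ n - 1 → κ ≠ κstar → post n a κ < post n a κstar := by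
  intro κ hκ1 hκ2 hne
  have hsum : 0 < ∑ k ∈ Finset.Icc 1 (n - 1), Q n a k :=
    Finset.sum_pos (fun k _ => Q_pos n a k) ⟨κ, Finset.mem_Icc.2 ⟨hκ1, hκ2⟩⟩
  refine div_lt_div_of_pos_right (Q_lt_Q hκ1 (by omega) (by omega) ?_ ?_ hne) hsum
  · exact fun i h₁ h₂ => (hpre i h₁ h₂).trans (neg_lt_zero.2 hγ)
  · exact fun i h₁ h₂ => hγ.trans (hpost i h₁ h₂)
end
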